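/- For every sufficiently large N there exists a 2-periodic function φ ∈ H²(ℝ) with zero mean such that ‖φ‖_{H²(−1,1)} ≤ C N^{3/2} and ‖φ‖_{L^∞} ≤ C N (with C independent of N), and such that for every 2-periodic u ∈ H² with u(0) = 0: ∫_{−1}^{1} (u''(x))² dx − ∫_{−1}^{1} φ'(x) u(x)² dx ≥ N ∫_{−1}^{1} u(x)² dx. -/

import Mathlib

open Real Filter Set

/-- The extension of `f` restricted to `[-1, 1]` to a `2`-periodic function. -/
noncomputable def periodize (f : ℝ → ℝ) (x : ℝ) : ℝ := f (x - 2 * round (x / 2))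

lemma periodize_periodic (f : ℝ → ℝ) : Function.Periodic (periodize f) 2 := by
  intro x
  have h : (x + 2) / 2 = x / 2 + 1 := by ring
  unfold periodize
  rw [h, round_add_one]
  push_cast
  ring_nf

lemma abs_sub_two_mul_round_le (x : ℝ) : |x - 2 * round (x / 2)| ≤ 1 := by
  have h := abs_sub_round (x / 2)
  rw [abs_le] at h ⊢
  constructor <;> linarith [h.1, h.2]

lemma periodize_eq_of_abs_le {f : ℝ → ℝ} (hf : ∀ x, 1 / 2 ≤ |x| → f x = 0) {x : ℝ} (n : ℤ)
    (hx : |x - 2 * n| ≤ 5 / 4) : periodize f x = f (x - 2 * n) := by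
  unfold periodize
  have h := abs_sub_two_mul_round_le x
  set j := round (x / 2)
  by_cases hj : j = n
  · rw [hj]
  · have hd : (1 : ℝ) ≤ |(j : ℝ) - n| := by
      exact_mod_cast Int.one_le_abs (sub_ne_zero.mpr hj)
    have h1 : 2 * |(j : ℝ) - n| ≤ |x - 2 * j| + |x - 2 * n| := by
      have := abs_sub (x - 2 * n) (x - 2 * j)
      rw [show x - 2 * n - (x - 2 * j) = 2 * ((j : ℝ) - n) by ring, abs_mul] at this
      norm_num at this
      linarith
    rw [hf _ (by linarith), hf _ (by linarith)]

lemma periodize_eventuallyEq {f : ℝ → ℝ} (hf : ∀ x, 1 / 2 ≤ |x| → f x = 0) (x : ℝ) :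
    periodize f =ᶠ[nhds x] fun y => f (y - 2 * round (x / 2)) := by
  filter_upwards [Metric.ball_mem_nhds x (show (0 : ℝ) < 1 / 4 by norm_num)] with y hy
  apply periodize_eq_of_abs_le hf
  rw [Metric.mem_ball, Real.dist_eq] at hy
  have h := abs_sub_two_mul_round_le x
  have := abs_add_le (y - x) (x - 2 * round (x / 2))
  rw [show y - x + (x - 2 * (round (x / 2) : ℝ)) = y - 2 * round (x / 2) by ring] at this
  linarith

lemma periodize_eq {f : ℝ → ℝ} (hf : ∀ x, 1 / 2 ≤ |x| → f x = 0) {x : ℝ} (hx : |x| ≤ 1) :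
    periodize f x = f x := by
  simpa using periodize_eq_of_abs_le hf (x := x) 0 (by simpa using hx.trans (by norm_num))

lemma continuous_periodize {f : ℝ → ℝ} (hf : ∀ x, 1 / 2 ≤ |x| → f x = 0) (hc : Continuous f) :
    Continuous (periodize f) := by
  rw [continuous_iff_continuousAt]
  intro x
  refine ContinuousAt.congr ?_ (periodize_eventuallyEq hf x).symm
  fun_prop

lemma hasDerivAt_periodize {f f' : ℝ → ℝ} (hf : ∀ x, 1 / 2 ≤ |x| → f x = 0)
    (hd : ∀ x, HasDerivAt f (f' x) x) (x : ℝ) :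
    HasDerivAt (periodize f) (periodize f' x) x :=
  ((hd _).comp_sub_const x _).congr_of_eventuallyEq (periodize_eventuallyEq hf x)

/-- The negative of the rescaled inner layer of the derivative of the weight. -/
noncomputable def profile (t : ℝ) : ℝ := (5 * t ^ 2 - 1) * max 0 (1 - t ^ 2) ^ 2 / 10

/-- The derivative of `profile`. -/
noncomputable def profileDeriv (t : ℝ) : ℝ :=
  t * max 0 (1 - t ^ 2) ^ 2 - 2 / 5 * t * (5 * t ^ 2 - 1) * max 0 (1 - t ^ 2)

/-- A majorant of `|profile|`. -/
noncomputable def envelope (t : ℝ) : ℝ := (5 * t ^ 2 + 1) * max 0 (1 - t ^ 2) ^ 2 / 10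

lemma max_zero_one_sub_sq_of_le {t : ℝ} (ht : 1 ≤ |t|) : max 0 (1 - t ^ 2) = 0 := by
  rw [← sq_abs]
  exact max_eq_left (by nlinarith)

lemma max_zero_one_sub_sq_of_mem {t : ℝ} (ht : t ∈ uIcc (-1 : ℝ) 1) :
    max 0 (1 - t ^ 2) = 1 - t ^ 2 := by
  rw [uIcc_of_le (by norm_num)] at ht
  exact max_eq_right (by nlinarith [ht.1, ht.2])

lemma profile_eq_zero {t : ℝ} (ht : 1 ≤ |t|) : profile t = 0 := by
  simp [profile, max_zero_one_sub_sq_of_le ht]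

lemma profileDeriv_eq_zero {t : ℝ} (ht : 1 ≤ |t|) : profileDeriv t = 0 := by
  simp [profileDeriv, max_zero_one_sub_sq_of_le ht]

lemma envelope_eq_zero {t : ℝ} (ht : 1 ≤ |t|) : envelope t = 0 := by
  simp [envelope, max_zero_one_sub_sq_of_le ht]

lemma continuous_profile : Continuous profile := by unfold profile; fun_prop

lemma continuous_profileDeriv : Continuous profileDeriv := by unfold profileDeriv; fun_prop

lemma continuous_envelope : Continuous envelope := by unfold envelope; fun_prop

lemma abs_profile_le (t : ℝ) : |profile t| ≤ envelope t := by
  have h := sq_nonneg (max 0 (1 - t ^ 2))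
  unfold profile envelope
  rw [abs_le]
  constructor <;> nlinarith [mul_nonneg (sq_nonneg t) h]

lemma envelope_nonneg (t : ℝ) : 0 ≤ envelope t := (abs_nonneg _).trans (abs_profile_le t)

lemma abs_profile_le_one (t : ℝ) : |profile t| ≤ 1 := by
  rcases le_total 1 |t| with ht | ht
  · simp [profile_eq_zero ht]
  · have h1 : t ^ 2 ≤ 1 := by rw [← sq_abs]; nlinarith [abs_nonneg t]
    refine (abs_profile_le t).trans ?_
    have h0 := sq_nonneg t
    unfold envelope
    rw [max_eq_right (by linarith)]
    have h2 : (1 - t ^ 2) ^ 2 ≤ 1 := by nlinarith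
    nlinarith [sq_nonneg (1 - t ^ 2)]

lemma profileDeriv_sq_le (t : ℝ) : profileDeriv t ^ 2 ≤ 9 := by
  rcases le_total 1 |t| with ht | ht
  · rw [profileDeriv_eq_zero ht]; norm_num
  · have h1 : t ^ 2 ≤ 1 := by rw [← sq_abs]; nlinarith [abs_nonneg t]
    have h0 := sq_nonneg t
    have hm : max 0 (1 - t ^ 2) = 1 - t ^ 2 := max_eq_right (by linarith)
    have e : profileDeriv t = t * ((1 - t ^ 2) * (7 / 5 - 3 * t ^ 2)) := by
      unfold profileDeriv; rw [hm]; ring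
    have h2 : ((1 - t ^ 2) * (7 / 5 - 3 * t ^ 2)) ^ 2 ≤ 9 := by
      rw [mul_pow]
      have : (1 - t ^ 2) ^ 2 ≤ 1 := by nlinarith
      have : (7 / 5 - 3 * t ^ 2) ^ 2 ≤ 9 := by nlinarith
      nlinarith [sq_nonneg (1 - t ^ 2), sq_nonneg (7 / 5 - 3 * t ^ 2)]
    rw [e, mul_pow]
    nlinarith [sq_nonneg ((1 - t ^ 2) * (7 / 5 - 3 * t ^ 2))]

lemma hasDerivAt_max_zero_sq (y : ℝ) :
    HasDerivAt (fun z : ℝ => max 0 z ^ 2) (2 * max 0 y) y := by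
  rcases lt_trichotomy y 0 with h | rfl | h
  · have e : (fun z : ℝ => max 0 z ^ 2) =ᶠ[nhds y] fun _ => 0 := by
      filter_upwards [Iio_mem_nhds h] with z hz
      simp [max_eq_left (mem_Iio.mp hz).le]
    simpa [max_eq_left h.le] using (hasDerivAt_const y (0 : ℝ)).congr_of_eventuallyEq e
  · have hO : (fun z : ℝ => max 0 z ^ 2) =O[nhds 0] fun z => ‖z - 0‖ ^ 2 := by
      refine Asymptotics.IsBigO.of_bound 1 (Eventually.of_forall fun z => ?_)
      rcases le_total z 0 with hz | hz
      · simp [max_eq_left hz, sq_nonneg]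
      · simp [max_eq_right hz]
    simpa using (hO.hasFDerivAt (𝕜 := ℝ) one_lt_two).hasDerivAt
  · have e : (fun z : ℝ => max 0 z ^ 2) =ᶠ[nhds y] fun z => z ^ 2 := by
      filter_upwards [Ioi_mem_nhds h] with z hz
      simp [max_eq_right (mem_Ioi.mp hz).le]
    simpa [max_eq_right h.le] using (hasDerivAt_pow 2 y).congr_of_eventuallyEq e

lemma hasDerivAt_profile (t : ℝ) : HasDerivAt profile (profileDeriv t) t := by
  have h1 : HasDerivAt (fun t : ℝ => 1 - t ^ 2) (-(2 * t)) t := by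
    simpa using (hasDerivAt_pow 2 t).const_sub 1
  have h2 : HasDerivAt (fun t : ℝ => 5 * t ^ 2 - 1) (5 * (2 * t)) t := by
    simpa using ((hasDerivAt_pow 2 t).const_mul 5).sub_const 1
  have h3 := (h2.mul ((hasDerivAt_max_zero_sq (1 - t ^ 2)).comp t h1)).div_const 10
  refine h3.congr_deriv ?_
  simp only [profileDeriv, Function.comp]
  ring

lemma integral_profile : ∫ t in (-1 : ℝ)..1, profile t = -(16 / 525) := by
  have e : EqOn profile (fun t => (-1 + 7 * t ^ 2 - 11 * t ^ 4 + 5 * t ^ 6) / 10)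
      (uIcc (-1 : ℝ) 1) := fun t ht => by
    simp only [profile, max_zero_one_sub_sq_of_mem ht]; ring
  rw [intervalIntegral.integral_congr e, intervalIntegral.integral_div,
    intervalIntegral.integral_add (Continuous.intervalIntegrable (by fun_prop) _ _)
      (Continuous.intervalIntegrable (by fun_prop) _ _),
    intervalIntegral.integral_sub (Continuous.intervalIntegrable (by fun_prop) _ _)
      (Continuous.intervalIntegrable (by fun_prop) _ _),
    intervalIntegral.integral_add (Continuous.intervalIntegrable (by fun_prop) _ _)
      (Continuous.intervalIntegrable (by fun_prop) _ _)]
  simp only [intervalIntegral.integral_const_mul, integral_pow, intervalIntegral.integral_const]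
  norm_num

lemma integral_envelope : ∫ t in (-1 : ℝ)..1, envelope t = 32 / 175 := by
  have e : EqOn envelope (fun t => (1 + 3 * t ^ 2 - 9 * t ^ 4 + 5 * t ^ 6) / 10)
      (uIcc (-1 : ℝ) 1) := fun t ht => by
    simp only [envelope, max_zero_one_sub_sq_of_mem ht]; ring
  rw [intervalIntegral.integral_congr e, intervalIntegral.integral_div,
    intervalIntegral.integral_add (Continuous.intervalIntegrable (by fun_prop) _ _)
      (Continuous.intervalIntegrable (by fun_prop) _ _),
    intervalIntegral.integral_sub (Continuous.intervalIntegrable (by fun_prop) _ _)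
      (Continuous.intervalIntegrable (by fun_prop) _ _),
    intervalIntegral.integral_add (Continuous.intervalIntegrable (by fun_prop) _ _)
      (Continuous.intervalIntegrable (by fun_prop) _ _)]
  simp only [intervalIntegral.integral_const_mul, integral_pow, intervalIntegral.integral_const]
  norm_num

lemma integral_sq_mul_profile_sub_envelope :
    ∫ t in (-1 : ℝ)..1, t ^ 2 * (profile t - envelope t / 4) = 0 := by
  have e : EqOn (fun t => t ^ 2 * (profile t - envelope t / 4))
      (fun t => (-t ^ 2 + 5 * t ^ 4 - 7 * t ^ 6 + 3 * t ^ 8) / 8)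
      (uIcc (-1 : ℝ) 1) := fun t ht => by
    simp only [profile, envelope, max_zero_one_sub_sq_of_mem ht]; ring
  rw [intervalIntegral.integral_congr e, intervalIntegral.integral_div,
    intervalIntegral.integral_add (Continuous.intervalIntegrable (by fun_prop) _ _)
      (Continuous.intervalIntegrable (by fun_prop) _ _),
    intervalIntegral.integral_sub (Continuous.intervalIntegrable (by fun_prop) _ _)
      (Continuous.intervalIntegrable (by fun_prop) _ _),
    intervalIntegral.integral_add (Continuous.intervalIntegrable (by fun_prop) _ _)
      (Continuous.intervalIntegrable (by fun_prop) _ _)]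
  simp only [intervalIntegral.integral_const_mul, intervalIntegral.integral_neg, integral_pow]
  norm_num

lemma integral_comp_mul_of_eq_zero {g : ℝ → ℝ} (hc : Continuous g)
    (hg : ∀ t, 1 ≤ |t| → g t = 0) {k : ℝ} (hk : 1 ≤ k) :
    ∫ x in (-1 : ℝ)..1, g (k * x) = k⁻¹ * ∫ t in (-1 : ℝ)..1, g t := by
  have hi (a b : ℝ) : IntervalIntegrable g MeasureTheory.volume a b := hc.intervalIntegrable a b
  rw [intervalIntegral.integral_comp_mul_left _ (by positivity), smul_eq_mul,
    ← intervalIntegral.integral_add_adjacent_intervals (hi (k * -1) (-1)) (hi (-1) (k * 1)),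
    ← intervalIntegral.integral_add_adjacent_intervals (hi (-1) 1) (hi 1 (k * 1))]
  have h1 : ∫ t in (k * -1)..(-1), g t = 0 := by
    apply intervalIntegral.integral_zero_ae (Eventually.of_forall fun t ht => hg t ?_)
    rw [uIoc_of_le (by linarith)] at ht
    exact le_abs.mpr (Or.inr (by linarith [ht.2]))
  have h2 : ∫ t in (1 : ℝ)..(k * 1), g t = 0 := by
    apply intervalIntegral.integral_zero_ae (Eventually.of_forall fun t ht => hg t ?_)
    rw [uIoc_of_le (by linarith)] at ht
    exact le_abs.mpr (Or.inl ht.1.le)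
  rw [h1, h2]
  ring

/-- Cauchy–Schwarz against the constant function `1`. -/
lemma sq_integral_le {g : ℝ → ℝ} (hg : Continuous g) {a b : ℝ} (hab : a ≤ b) :
    (∫ t in a..b, g t) ^ 2 ≤ (b - a) * ∫ t in a..b, g t ^ 2 := by
  rcases hab.eq_or_lt with rfl | hlt
  · simp
  set I := ∫ t in a..b, g t with hI
  have h : 0 ≤ ∫ t in a..b, ((b - a) * g t - I) ^ 2 :=
    intervalIntegral.integral_nonneg hab fun t _ => sq_nonneg _
  have e : ∫ t in a..b, ((b - a) * g t - I) ^ 2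
      = (b - a) * ((b - a) * (∫ t in a..b, g t ^ 2) - I ^ 2) := by
    have : (fun t => ((b - a) * g t - I) ^ 2)
        = fun t => (b - a) ^ 2 * g t ^ 2 - 2 * (b - a) * I * g t + I ^ 2 := by
      funext t; ring
    rw [this, intervalIntegral.integral_add (Continuous.intervalIntegrable (by fun_prop) _ _)
        (by simp),
      intervalIntegral.integral_sub (Continuous.intervalIntegrable (by fun_prop) _ _)
        (Continuous.intervalIntegrable (by fun_prop) _ _)]
    simp only [intervalIntegral.integral_const_mul, intervalIntegral.integral_const, ← hI,
      smul_eq_mul]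
    ring
  rw [e] at h
  have := nonneg_of_mul_nonneg_right h (by linarith)
  linarith

lemma sq_sub_linear_le {u : ℝ → ℝ} (hu : ContDiff ℝ 2 u) (h0 : u 0 = 0) {x d : ℝ}
    (hx : |x| ≤ d) (hd : d ≤ 1) :
    (u x - deriv u 0 * x) ^ 2 ≤ d ^ 3 * ∫ t in (-1 : ℝ)..1, deriv (deriv u) t ^ 2 := by
  set S := ∫ t in (-1 : ℝ)..1, deriv (deriv u) t ^ 2 with hS
  have hd0 : 0 ≤ d := (abs_nonneg x).trans hx
  have hS0 : 0 ≤ S := intervalIntegral.integral_nonneg (by norm_num) fun t _ => sq_nonneg _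
  have hu1 : ContDiff ℝ 1 (deriv u) := ((contDiff_succ_iff_deriv (n := 1)).mp hu).2.2
  have hc : Continuous (deriv (deriv u)) := hu1.continuous_deriv le_rfl
  have hdu (y : ℝ) : HasDerivAt u (deriv u y) y :=
    ((hu.differentiable (by norm_num)) y).hasDerivAt
  have hddu (y : ℝ) : HasDerivAt (deriv u) (deriv (deriv u) y) y :=
    ((hu1.differentiable (by norm_num)) y).hasDerivAt
  have hsq (a b : ℝ) (ha : -1 ≤ a) (hab : a ≤ b) (hb : b ≤ 1) :
      (deriv u b - deriv u a) ^ 2 ≤ (b - a) * S := by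
    rw [← intervalIntegral.integral_eq_sub_of_hasDerivAt (fun y _ => hddu y)
      (hc.intervalIntegrable _ _)]
    refine (sq_integral_le hc hab).trans (mul_le_mul_of_nonneg_left ?_ (by linarith))
    exact intervalIntegral.integral_mono_interval ha hab hb
      (Eventually.of_forall fun t => sq_nonneg _) ((hc.pow 2).intervalIntegrable _ _)
  have hslope (y : ℝ) (hy : |y| ≤ d) : |deriv u y - deriv u 0| ≤ √(d * S) := by
    apply Real.abs_le_sqrt
    rw [abs_le] at hy
    rcases le_total 0 y with h | h
    · exact (hsq 0 y (by norm_num) h (by linarith)).trans (by nlinarith)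
    · rw [← neg_sq, neg_sub]
      exact (hsq y 0 (by linarith) h (by norm_num)).trans (by nlinarith)
  have hmv := (convex_Icc (-d) d).norm_image_sub_le_of_norm_hasDerivWithin_le
    (f := fun y => u y - deriv u 0 * y) (f' := fun y => deriv u y - deriv u 0)
    (C := √(d * S)) (x := 0) (y := x)
    (fun y _ => ((hdu y).sub (by simpa using (hasDerivAt_id y).const_mul _)).hasDerivWithinAt)
    (fun y hy => hslope y (abs_le.mpr hy)) ⟨by linarith, hd0⟩ (abs_le.mp hx)
  simp only [h0, mul_zero, sub_zero, Real.norm_eq_abs] at hmv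
  have : |u x - deriv u 0 * x| ≤ √(d * S) * d :=
    hmv.trans (mul_le_mul_of_nonneg_left hx (Real.sqrt_nonneg _))
  calc (u x - deriv u 0 * x) ^ 2 = |u x - deriv u 0 * x| ^ 2 := (sq_abs _).symm
    _ ≤ (√(d * S) * d) ^ 2 := by gcongr
    _ = d ^ 3 * S := by rw [mul_pow, Real.sq_sqrt (by positivity)]; ring

/-- The rescaled profile is a nonnegative perturbation of the fourth-derivative form on
functions vanishing at the origin. -/
lemma profile_form_nonneg {u : ℝ → ℝ} (hu : ContDiff ℝ 2 u) (h0 : u 0 = 0) {k : ℝ}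
    (hk : 1 ≤ k) :
    0 ≤ (∫ x in (-1 : ℝ)..1, deriv (deriv u) x ^ 2)
      + ∫ x in (-1 : ℝ)..1, k ^ 4 * profile (k * x) * u x ^ 2 := by
  set S := ∫ x in (-1 : ℝ)..1, deriv (deriv u) x ^ 2 with hS
  set a := deriv u 0
  have hS0 : 0 ≤ S := intervalIntegral.integral_nonneg (by norm_num) fun t _ => sq_nonneg _
  have hk0 : 0 < k := by linarith
  have hcp := continuous_profile
  have hce := continuous_envelope
  have hcu := hu.continuous
  have hpt (x : ℝ) :
      a ^ 2 * k ^ 2 * ((k * x) ^ 2 * (profile (k * x) - envelope (k * x) / 4))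
        - 5 * k * S * envelope (k * x) ≤ k ^ 4 * profile (k * x) * u x ^ 2 := by
    rcases le_total 1 |k * x| with h | h
    · simp [profile_eq_zero h, envelope_eq_zero h]
    · have hx : |x| ≤ k⁻¹ := by
        rw [abs_mul, abs_of_pos hk0] at h
        rw [← one_div, le_div_iff₀ hk0]; linarith
      have hr := sq_sub_linear_le hu h0 hx (inv_le_one_of_one_le₀ hk)
      set r := u x - a * x with hr'
      have hur : u x = a * x + r := by rw [hr']; ring
      have hE := envelope_nonneg (k * x)
      have hp := abs_le.mp (abs_profile_le (k * x))
      set p := profile (k * x)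
      set E := envelope (k * x)
      have h1 : a ^ 2 * x ^ 2 * (p - E / 4) - 5 * E * r ^ 2 ≤ p * u x ^ 2 := by
        rw [hur]
        nlinarith [mul_nonneg (by linarith [hp.1] : 0 ≤ E + p) (sq_nonneg (a * x / 2 + 2 * r)),
          mul_nonneg (by linarith [hp.2] : 0 ≤ E - p) (sq_nonneg (a * x / 2 - 2 * r)),
          mul_nonneg (by linarith [hp.1] : 0 ≤ E + p) (sq_nonneg r),
          mul_nonneg (by linarith [hp.2] : 0 ≤ E - p) (sq_nonneg r)]
      have h2 : k ^ 4 * (5 * E * r ^ 2) ≤ 5 * k * S * E := by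
        calc k ^ 4 * (5 * E * r ^ 2) ≤ k ^ 4 * (5 * E * (k⁻¹ ^ 3 * S)) := by gcongr
          _ = 5 * k * S * E := by field_simp
      have h3 := mul_le_mul_of_nonneg_left h1 (by positivity : 0 ≤ k ^ 4)
      linarith
  have hmono := intervalIntegral.integral_mono (a := (-1 : ℝ)) (b := 1)
    (μ := MeasureTheory.volume) (by norm_num)
    (Continuous.intervalIntegrable (by fun_prop) _ _)
    (Continuous.intervalIntegrable (by fun_prop) _ _) hpt
  rw [intervalIntegral.integral_sub (Continuous.intervalIntegrable (by fun_prop) _ _)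
      (Continuous.intervalIntegrable (by fun_prop) _ _),
    intervalIntegral.integral_const_mul, intervalIntegral.integral_const_mul,
    integral_comp_mul_of_eq_zero (g := fun t => t ^ 2 * (profile t - envelope t / 4))
      (by fun_prop) (fun t ht => by simp [profile_eq_zero ht, envelope_eq_zero ht]) hk,
    integral_comp_mul_of_eq_zero hce (fun t ht => envelope_eq_zero ht) hk,
    integral_sq_mul_profile_sub_envelope, integral_envelope] at hmono
  have e : 5 * k * S * (k⁻¹ * (32 / 175)) = 32 / 35 * S := by field_simp; ring
  rw [e] at hmono
  linarith

/-- Bronski–Gambill type lemma (scaled to period 2): for every sufficiently large `N`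
there is a `2`-periodic zero-mean `φ` with `‖φ‖_{H²(-1,1)} ≤ C N^{3/2}`,
`‖φ‖_{L^∞} ≤ C N` (with `C` independent of `N`) and
`∫ (u'')² - ∫ φ' u² ≥ N ∫ u²` for every `2`-periodic `H²` function `u` with `u(0) = 0`. -/
theorem bronski_gambill : ∃ C N₀ : ℝ, 0 < C ∧ ∀ N ≥ N₀, ∃ φ : ℝ → ℝ,
    ContDiff ℝ 2 φ ∧ Function.Periodic φ 2 ∧ (∫ x in (-1:ℝ)..1, φ x) = 0 ∧
    (∫ x in (-1:ℝ)..1, (φ x) ^ 2 + (deriv φ x) ^ 2 + (deriv (deriv φ) x) ^ 2)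
      ≤ (C * N ^ ((3:ℝ)/2)) ^ 2 ∧
    (∀ x, |φ x| ≤ C * N) ∧
    ∀ u : ℝ → ℝ, ContDiff ℝ 2 u → Function.Periodic u 2 → u 0 = 0 →
      (∫ x in (-1:ℝ)..1, (deriv (deriv u) x) ^ 2)
          - (∫ x in (-1:ℝ)..1, deriv φ x * (u x) ^ 2)
        ≥ N * ∫ x in (-1:ℝ)..1, (u x) ^ 2 := by
  refine ⟨10000, 1, by norm_num, fun N hN => ?_⟩
  have hN0 : 0 < N := by linarith
  obtain ⟨k, hk, hkN⟩ : ∃ k : ℝ, 2 ≤ k ∧ k ^ 3 = 525 / 8 * N := by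
    refine ⟨(525 / 8 * N) ^ ((1 : ℝ) / 3), ?_, ?_⟩
    · rw [show (2 : ℝ) = (2 ^ (3 : ℝ)) ^ ((1 : ℝ) / 3) by
        rw [← Real.rpow_mul (by norm_num)]; norm_num]
      exact Real.rpow_le_rpow (by positivity) (by norm_num; linarith) (by norm_num)
    · rw [← Real.rpow_natCast, ← Real.rpow_mul (by positivity)]; norm_num
  have hk1 : 1 ≤ k := by linarith
  have hk0 : 0 < k := by linarith
  have hkx {x : ℝ} (hx : 1 / 2 ≤ |x|) : 1 ≤ |k * x| := by
    rw [abs_mul, abs_of_pos hk0]; nlinarith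
  have hcp := continuous_profile
  have hcd := continuous_profileDeriv
  have hce := continuous_envelope
  set f : ℝ → ℝ := fun x => k ^ 4 * profile (k * x) with hf
  set f' : ℝ → ℝ := fun x => k ^ 5 * profileDeriv (k * x) with hf'
  have hf0 (x : ℝ) (hx : 1 / 2 ≤ |x|) : f x = 0 := by simp [hf, profile_eq_zero (hkx hx)]
  have hfd_zero (x : ℝ) (hx : 1 / 2 ≤ |x|) : f' x = 0 := by
    simp [hf', profileDeriv_eq_zero (hkx hx)]
  have hfd (x : ℝ) : HasDerivAt f (f' x) x := by
    have h := ((hasDerivAt_profile (k * x)).comp x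
      ((hasDerivAt_id x).const_mul k)).const_mul (k ^ 4)
    refine h.congr_deriv ?_
    simp only [hf']
    ring
  have hfc : Continuous f := by fun_prop
  have hfd_cont : Continuous f' := by fun_prop
  set q : ℝ → ℝ := fun x => N + periodize f x with hq
  have hqc : Continuous q := continuous_const.add (continuous_periodize hf0 hfc)
  have hqper : Function.Periodic q 2 := fun x => by simp only [hq, periodize_periodic f x]
  have hqd (x : ℝ) : HasDerivAt q (periodize f' x) x :=
    (hasDerivAt_periodize hf0 hfd x).const_add N
  have hqeq {x : ℝ} (hx : |x| ≤ 1) : q x = N + f x := by simp only [hq, periodize_eq hf0 hx]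
  have hmem {x : ℝ} (hx : x ∈ uIcc (-1 : ℝ) 1) : |x| ≤ 1 := by
    rw [uIcc_of_le (by norm_num)] at hx; exact abs_le.mpr hx
  have hmean : ∫ x in (-1 : ℝ)..1, q x = 0 := by
    rw [intervalIntegral.integral_congr (g := fun x => N + f x) fun x hx => hqeq (hmem hx),
      intervalIntegral.integral_add (by simp) (hfc.intervalIntegrable _ _)]
    simp only [hf, intervalIntegral.integral_const_mul, intervalIntegral.integral_const]
    rw [integral_comp_mul_of_eq_zero hcp (fun t ht => profile_eq_zero ht) hk1, integral_profile]
    have : k ^ 4 * (k⁻¹ * -(16 / 525)) = -(16 / 525) * k ^ 3 := by field_simp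
    rw [this, hkN, smul_eq_mul]
    ring
  set φ : ℝ → ℝ := fun x => -∫ t in (0 : ℝ)..x, q t with hφ
  have hφd (x : ℝ) : HasDerivAt φ (-q x) x :=
    (intervalIntegral.integral_hasDerivAt_right (hqc.intervalIntegrable _ _)
      hqc.stronglyMeasurable.stronglyMeasurableAtFilter hqc.continuousAt).neg
  have hφ1 : deriv φ = fun x => -q x := funext fun x => (hφd x).deriv
  have hφ2 : deriv (deriv φ) = fun x => -periodize f' x := by
    rw [hφ1]; exact funext fun x => (hqd x).neg.deriv
  have hφC : ContDiff ℝ 2 φ := by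
    rw [show (2 : WithTop ℕ∞) = 1 + 1 by norm_num, contDiff_succ_iff_deriv]
    refine ⟨fun x => (hφd x).differentiableAt, by simp, ?_⟩
    rw [contDiff_one_iff_deriv, hφ2, hφ1]
    exact ⟨fun x => (hqd x).neg.differentiableAt, (continuous_periodize hfd_zero hfd_cont).neg⟩
  have hφper : Function.Periodic φ 2 := fun x => by
    have h := hqper.intervalIntegral_add_eq x (-1)
    norm_num only at h
    rw [hmean] at h
    simp only [hφ]
    rw [← intervalIntegral.integral_add_adjacent_intervals (hqc.intervalIntegrable 0 x)
      (hqc.intervalIntegrable x (x + 2)), h, add_zero]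
  have hφ_odd {x : ℝ} (hx : x ∈ uIcc (-1 : ℝ) 1) : φ (-x) = -φ x := by
    have h := intervalIntegral.integral_comp_neg (a := 0) (b := x) q
    have hs : EqOn (fun t => q (-t)) q (uIcc 0 x) := fun t ht => by
      have ht1 : |t| ≤ 1 := hmem (uIcc_subset_uIcc (by simp) hx ht)
      simp only
      rw [hqeq ht1, hqeq (by rwa [abs_neg])]
      simp [hf, profile]
    rw [intervalIntegral.integral_congr hs, neg_zero] at h
    simp only [hφ, h, intervalIntegral.integral_symm (-x) 0]
  have hφmean : ∫ x in (-1 : ℝ)..1, φ x = 0 := by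
    have h := intervalIntegral.integral_comp_neg (a := -1) (b := 1) φ
    rw [neg_neg, intervalIntegral.integral_congr (g := fun x => -φ x) fun x hx => hφ_odd hx,
      intervalIntegral.integral_neg] at h
    linarith
  have hφ_bound (x : ℝ) : |φ x| ≤ 14 * N := by
    have hx := abs_sub_two_mul_round_le x
    have hper : φ x = φ (x - 2 * round (x / 2)) := by
      have := hφper.sub_zsmul_eq (x := x) (round (x / 2))
      rw [← this, zsmul_eq_mul, mul_comm]
    rw [hper]
    set y := x - 2 * round (x / 2)
    have hI : ∫ t in (-1 : ℝ)..1, (N + k ^ 4 * envelope (k * t)) = 14 * N := by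
      rw [intervalIntegral.integral_add (by simp)
        (Continuous.intervalIntegrable (by fun_prop) _ _), intervalIntegral.integral_const_mul,
        intervalIntegral.integral_const,
        integral_comp_mul_of_eq_zero hce (fun t ht => envelope_eq_zero ht) hk1, integral_envelope]
      have : k ^ 4 * (k⁻¹ * (32 / 175)) = 32 / 175 * k ^ 3 := by field_simp
      rw [this, hkN, smul_eq_mul]
      ring
    have hG (t : ℝ) (ht : |t| ≤ 1) : |q t| ≤ N + k ^ 4 * envelope (k * t) := by
      rw [hqeq ht]
      refine (abs_add_le _ _).trans ?_
      simp only [hf, abs_mul, abs_of_pos hN0, abs_of_pos (pow_pos hk0 4)]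
      gcongr
      exact abs_profile_le _
    have hab (a b : ℝ) (ha : -1 ≤ a) (hab : a ≤ b) (hb : b ≤ 1) :
        |∫ t in a..b, q t| ≤ 14 * N := by
      rw [← hI]
      refine (intervalIntegral.abs_integral_le_integral_abs hab).trans ?_
      refine (intervalIntegral.integral_mono_on hab (hqc.abs.intervalIntegrable _ _)
        (Continuous.intervalIntegrable (by fun_prop) _ _) fun t ht =>
          hG t (abs_le.mpr ⟨ha.trans ht.1, ht.2.trans hb⟩)).trans ?_
      refine intervalIntegral.integral_mono_interval ha hab hb (Eventually.of_forall fun t => ?_)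
        (Continuous.intervalIntegrable (by fun_prop) _ _)
      have := envelope_nonneg (k * t)
      simp only [Pi.zero_apply]
      positivity
    have hy' := abs_le.mp hx
    simp only [hφ, abs_neg]
    rcases le_total 0 y with h | h
    · exact hab 0 y (by norm_num) h hy'.2
    · rw [intervalIntegral.integral_symm, abs_neg]
      exact hab y 0 hy'.1 h (by norm_num)
  refine ⟨φ, hφC, hφper, hφmean, ?_, fun x => (hφ_bound x).trans (by linarith), ?_⟩
  · have hφc : Continuous φ := hφC.continuous
    have hpt (x : ℝ) (hx : x ∈ Icc (-1 : ℝ) 1) :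
        φ x ^ 2 + deriv φ x ^ 2 + deriv (deriv φ) x ^ 2
          ≤ (198 * N ^ 2 + 2 * k ^ 8) + k ^ 10 * profileDeriv (k * x) ^ 2 := by
      have hx1 := abs_le.mpr hx
      rw [hφ2, hφ1]
      simp only [hqeq hx1, periodize_eq hfd_zero hx1, neg_sq]
      simp only [hf, hf']
      have h1 : φ x ^ 2 ≤ (14 * N) ^ 2 := by
        rw [← sq_abs]; gcongr; exact hφ_bound x
      have h2 : profile (k * x) ^ 2 ≤ 1 := (sq_le_one_iff_abs_le_one _).mpr (abs_profile_le_one _)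
      have h3 := mul_le_mul_of_nonneg_left h2 (by positivity : 0 ≤ k ^ 8)
      have h4 := sq_nonneg (N - k ^ 4 * profile (k * x))
      nlinarith
    have hI : ∫ t in (-1 : ℝ)..1, profileDeriv t ^ 2 ≤ 18 := by
      refine (intervalIntegral.integral_mono (by norm_num)
        (Continuous.intervalIntegrable (by fun_prop) _ _) (by simp) profileDeriv_sq_le).trans ?_
      norm_num
    have hφ1c : Continuous (deriv φ) := by rw [hφ1]; exact hqc.neg
    have hφ2c : Continuous (deriv (deriv φ)) := by
      rw [hφ2]; exact (continuous_periodize hfd_zero hfd_cont).neg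
    refine (intervalIntegral.integral_mono_on (by norm_num)
      (Continuous.intervalIntegrable (by fun_prop) _ _)
      (Continuous.intervalIntegrable (by fun_prop) _ _) hpt).trans ?_
    rw [intervalIntegral.integral_add (by simp) (Continuous.intervalIntegrable (by fun_prop) _ _),
      intervalIntegral.integral_const_mul, intervalIntegral.integral_const,
      integral_comp_mul_of_eq_zero (g := fun t => profileDeriv t ^ 2) (by fun_prop)
        (fun t ht => by simp [profileDeriv_eq_zero ht]) hk1, smul_eq_mul]
    have hN3 : (N ^ ((3 : ℝ) / 2)) ^ 2 = N ^ 3 := by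
      rw [← Real.rpow_natCast, ← Real.rpow_mul hN0.le, ← Real.rpow_natCast]; norm_num
    have h9 : k ^ 10 * (k⁻¹ * ∫ t in (-1 : ℝ)..1, profileDeriv t ^ 2) ≤ k ^ 9 * 18 := by
      calc _ = k ^ 9 * ∫ t in (-1 : ℝ)..1, profileDeriv t ^ 2 := by field_simp
        _ ≤ _ := by gcongr
    have hk9 : k ^ 9 = (525 / 8) ^ 3 * N ^ 3 := by
      rw [show k ^ 9 = (k ^ 3) ^ 3 by ring, hkN, mul_pow]
    have hk89 : k ^ 8 ≤ k ^ 9 := pow_le_pow_right₀ hk1 (by norm_num)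
    have hN23 : N ^ 2 ≤ N ^ 3 := pow_le_pow_right₀ hN (by norm_num)
    have hN30 : 0 ≤ N ^ 3 := by positivity
    rw [mul_pow, hN3]
    rw [hk9] at h9 hk89
    linarith
  · intro u hu _ hu0
    have hform := profile_form_nonneg hu hu0 hk1
    have hcu := hu.continuous
    have e : ∫ x in (-1 : ℝ)..1, deriv φ x * u x ^ 2
        = -(N * ∫ x in (-1 : ℝ)..1, u x ^ 2) - ∫ x in (-1 : ℝ)..1, f x * u x ^ 2 := by
      rw [← intervalIntegral.integral_const_mul, ← intervalIntegral.integral_neg,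
        ← intervalIntegral.integral_sub (Continuous.intervalIntegrable (by fun_prop) _ _)
          (Continuous.intervalIntegrable (by fun_prop) _ _)]
      refine intervalIntegral.integral_congr fun x hx => ?_
      simp only [hφ1, hqeq (hmem hx)]
      ring
    rw [e]
    linarith
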